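/- arXiv:1502.00776 — 4 statements merged into one kernel-verified Lean document; each statement's English description precedes it below -/
import Mathlib

section
/- If a non-bipartite binary Cayley graph G = Cay(Γ, Ω) admits a graph homomorphism to the complete graph K_4, then every graph homomorphism from G to K_4 is surjective. -/
open SimpleGraph

/-- The Cayley graph of the binary group `(ℤ/2ℤ)^n` with connection set `Ω`:
vertices are the vectors, and `u ~ v` iff `u ≠ v` and `u + v ∈ Ω`. -/
def binCayley {n : ℕ} (Ω : Set (Fin n → ZMod 2)) : SimpleGraph (Fin n → ZMod 2) :=
  SimpleGraph.fromRel (fun u v => u + v ∈ Ω)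

/-- The projective cube of dimension `d`: the Cayley graph of `(ℤ/2ℤ)^d` whose
connection set consists of the standard basis vectors together with the all-ones vector. -/
def projCube (d : ℕ) : SimpleGraph (Fin d → ZMod 2) :=
  binCayley ({x | ∃ i, x = Pi.single i 1} ∪ {x | x = fun _ => 1})

/-- The lift to `{1, -1} ⊆ ℤ` of the difference of two distinct elements of `ℤ/3ℤ`. -/
def colorStep (p q : ZMod 3) : ℤ := if q = p + 1 then 1 else -1

theorem odd_colorStep (p q : ZMod 3) : Odd (colorStep p q) := by
  unfold colorStep
  split <;> decide

theorem colorStep_add_swap : ∀ {p q : ZMod 3}, p ≠ q → colorStep p q + colorStep q p = 0 := by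
  decide

/-- A 4-cycle has winding number zero under a 3-colouring. -/
theorem colorStep_square : ∀ {p q r s : ZMod 3}, p ≠ q → q ≠ s → p ≠ r → r ≠ s →
    colorStep p q + colorStep q s = colorStep p r + colorStep r s := by
  decide

/-- The winding of the colouring `g` along the walk that starts at `x` and whose successive
steps are the entries of the list. -/
def winding {V : Type*} [Add V] (g : V → ZMod 3) : V → List V → ℤ
  | _, [] => 0
  | x, a :: l => colorStep (g x) (g (x + a)) + winding g (x + a) l

section Winding

variable {V : Type*} [AddCommGroup V] {g : V → ZMod 3} {Ω : Set V}

theorem winding_append (g : V → ZMod 3) (x : V) (l₁ l₂ : List V) :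
    winding g x (l₁ ++ l₂) = winding g x l₁ + winding g (x + l₁.sum) l₂ := by
  induction l₁ generalizing x with
  | nil => simp [winding]
  | cons a l ih => simp [winding, ih, add_assoc]

theorem odd_winding_iff (g : V → ZMod 3) (x : V) (l : List V) :
    Odd (winding g x l) ↔ Odd l.length := by
  induction l generalizing x with
  | nil => simp [winding]
  | cons a l ih =>
    have h := odd_colorStep (g x) (g (x + a))
    rw [winding, Int.odd_add, List.length_cons, Nat.odd_add_one, ← ih (x + a), Int.not_odd_iff_even]
    simp [h]

theorem winding_perm (hg : ∀ x, ∀ a ∈ Ω, g x ≠ g (x + a)) {l₁ l₂ : List V} (h : l₁.Perm l₂)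
    (hl : ∀ a ∈ l₁, a ∈ Ω) (x : V) : winding g x l₁ = winding g x l₂ := by
  induction h generalizing x with
  | nil => rfl
  | cons a _ ih =>
    rw [winding, winding, ih (fun b hb => hl b (List.mem_cons_of_mem _ hb))]
  | swap a b l =>
    have ha : a ∈ Ω := hl a (by simp)
    have hb : b ∈ Ω := hl b (by simp)
    have hsq := colorStep_square (hg x b hb) (hg (x + b) a ha) (hg x a ha)
      (by simpa [add_right_comm] using hg (x + a) b hb)
    simp only [winding, add_right_comm x a b]
    linarith
  | trans h₁ _ ih₁ ih₂ =>
    rw [ih₁ hl, ih₂ fun a ha => hl a (h₁.mem_iff.2 ha)]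

theorem winding_append_self (h2 : ∀ x : V, x + x = 0) (hg : ∀ x, ∀ a ∈ Ω, g x ≠ g (x + a))
    {l : List V} (hl : ∀ a ∈ l, a ∈ Ω) (x : V) : winding g x (l ++ l) = 0 := by
  induction l with
  | nil => rfl
  | cons a l ih =>
    have hp : (a :: l ++ a :: l).Perm (a :: a :: (l ++ l)) := by
      simp [List.perm_middle]
    have hx : x + a + a = x := by rw [add_assoc, h2, add_zero]
    rw [winding_perm hg hp (by grind), winding, winding, hx,
      ih fun b hb => hl b (List.mem_cons_of_mem _ hb)]
    linarith [colorStep_add_swap (hg x a (hl a (by simp)))]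

/-- A 3-colouring of an elementary abelian 2-group that is proper for the steps in `Ω` excludes
vanishing sums of an odd number of elements of `Ω`. -/
theorem not_odd_length_of_sum_eq_zero (h2 : ∀ x : V, x + x = 0)
    (hg : ∀ x, ∀ a ∈ Ω, g x ≠ g (x + a)) {l : List V} (hl : ∀ a ∈ l, a ∈ Ω)
    (hsum : l.sum = 0) : ¬ Odd l.length := by
  intro hodd
  have h := winding_append_self h2 hg hl 0
  rw [winding_append, hsum, add_zero] at h
  have h' := (odd_winding_iff g 0 l).2 hodd
  rw [show winding g 0 l = 0 by omega] at h'
  simp at h'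

end Winding

theorem binary_add_self {n : ℕ} (x : Fin n → ZMod 2) : x + x = 0 :=
  funext fun i => CharTwo.add_self_eq_zero (x i)

theorem binCayley_adj_add {n : ℕ} {Ω : Set (Fin n → ZMod 2)} (h0 : 0 ∉ Ω)
    (x : Fin n → ZMod 2) {a : Fin n → ZMod 2} (ha : a ∈ Ω) : (binCayley Ω).Adj x (x + a) := by
  refine ⟨fun h => h0 ?_, Or.inl ?_⟩
  · rwa [← left_eq_add.1 h]
  · show x + (x + a) ∈ Ω
    rwa [← add_assoc, binary_add_self, zero_add]

theorem binCayley_walk_steps {n : ℕ} {Ω : Set (Fin n → ZMod 2)} {u v : Fin n → ZMod 2}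
    (w : (binCayley Ω).Walk u v) :
    ∃ l : List (Fin n → ZMod 2), (∀ a ∈ l, a ∈ Ω) ∧ l.length = w.length ∧ l.sum = u + v := by
  induction w with
  | nil => exact ⟨[], by simp, rfl, (binary_add_self _).symm⟩
  | @cons u v t h w ih =>
    obtain ⟨l, hl, hlen, hsum⟩ := ih
    have huv : u + v ∈ Ω := h.2.elim id fun h' => add_comm v u ▸ h'
    refine ⟨(u + v) :: l, by simpa using ⟨huv, hl⟩, by simp [hlen], ?_⟩
    rw [List.sum_cons, hsum, add_assoc, ← add_assoc v, binary_add_self, zero_add]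

theorem exists_three_coloring_of_ne (c : Fin 4) :
    ∃ φ : Fin 4 → ZMod 3, ∀ a b, a ≠ c → b ≠ c → a ≠ b → φ a ≠ φ b := by
  refine ⟨fun a => ((a - c - 1 : Fin 4).val : ZMod 3), ?_⟩
  revert c
  decide

/-- (Payan) If a non-bipartite binary Cayley graph (one containing an odd cycle)
admits a homomorphism to `K₄`, then every homomorphism from it to `K₄` is surjective. -/
theorem binCayley_hom_to_K4_surjective (n : ℕ)
    (Ω : Set (Fin n → ZMod 2)) (h0 : 0 ∉ Ω)
    (hodd : ∃ (u : Fin n → ZMod 2) (w : (binCayley Ω).Walk u u),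
      w.IsCycle ∧ Odd w.length)
    (hhom : Nonempty (binCayley Ω →g completeGraph (Fin 4)))
    (f : binCayley Ω →g completeGraph (Fin 4)) :
    Function.Surjective f := by
  by_contra hf
  obtain ⟨c, hc⟩ := not_forall.1 hf
  have hc' : ∀ x, f x ≠ c := fun x hx => hc ⟨x, hx⟩
  obtain ⟨φ, hφ⟩ := exists_three_coloring_of_ne c
  obtain ⟨u, w, -, hw⟩ := hodd
  obtain ⟨l, hl, hlen, hsum⟩ := binCayley_walk_steps w
  have hg : ∀ x, ∀ a ∈ Ω, φ (f x) ≠ φ (f (x + a)) := fun x a ha =>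
    hφ _ _ (hc' _) (hc' _) (f.map_adj (binCayley_adj_add h0 x ha)).ne
  exact not_odd_length_of_sum_eq_zero (g := fun x => φ (f x)) binary_add_self hg hl
    (hsum.trans (binary_add_self u)) (hlen ▸ hw)
end

section
/- For every n ≥ 3, the power graph of the cycle C_n on n vertices has exactly two connected components, each isomorphic to the projective cube PC_{n−1} of dimension n−1. -/
open SimpleGraph

/-- The power graph of `G`: vertices are the subsets of `V(G)`, two subsets being
adjacent iff their symmetric difference is the vertex set `{u, v}` of an edge of `G`. -/
def powerGraph {V : Type*} (G : SimpleGraph V) : SimpleGraph (Set V) :=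
  SimpleGraph.fromRel (fun A B => ∃ u v, G.Adj u v ∧ symmDiff A B = {u, v})

namespace SimpleGraph

variable {V W K : Type*} {G : SimpleGraph V} {H : SimpleGraph W}

/-- If `G` is a disjoint union of copies of the preconnected graph `H` indexed by `K`, then two
vertices are reachable from each other iff they lie in the same copy. -/
theorem reachable_iff_snd_eq (hH : H.Preconnected) (e : V ≃ W × K)
    (he : ∀ a b, G.Adj a b ↔ (e a).2 = (e b).2 ∧ H.Adj (e a).1 (e b).1) (a b : V) :
    G.Reachable a b ↔ (e a).2 = (e b).2 := by
  constructor
  · rintro ⟨p⟩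
    induction p with
    | nil => rfl
    | cons h _ ih => exact ((he _ _).1 h).1.trans ih
  · intro h
    let f : H →g G := ⟨fun w => e.symm (w, (e a).2), fun {x y} hxy => by
      rw [he]; simpa using hxy⟩
    have hf := (hH (e a).1 (e b).1).map f
    have ha : f (e a).1 = a := e.symm_apply_apply a
    have hb : f (e b).1 = b := by
      change e.symm ((e b).1, (e a).2) = b
      rw [h]
      exact e.symm_apply_apply b
    rwa [ha, hb] at hf

/-- If `G` is a disjoint union of copies of the preconnected graph `H`, then each connected
component of `G` is isomorphic to `H`. -/
theorem nonempty_induce_supp_iso (hH : H.Preconnected) (e : V ≃ W × K)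
    (he : ∀ a b, G.Adj a b ↔ (e a).2 = (e b).2 ∧ H.Adj (e a).1 (e b).1)
    (C : G.ConnectedComponent) : Nonempty (G.induce C.supp ≃g H) := by
  induction C using ConnectedComponent.ind with | _ c
  have hmem (a : V) : a ∈ (G.connectedComponentMk c).supp ↔ (e a).2 = (e c).2 := by
    rw [ConnectedComponent.mem_supp_iff, ConnectedComponent.eq,
      reachable_iff_snd_eq hH e he]
  refine ⟨⟨⟨fun a => (e a).1, fun w => ⟨e.symm (w, (e c).2), by simp [hmem]⟩, ?_, ?_⟩, ?_⟩⟩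
  · rintro ⟨a, ha⟩
    rw [hmem] at ha
    ext
    simp [← ha]
  · intro w
    simp
  · rintro ⟨a, ha⟩ ⟨b, hb⟩
    rw [hmem] at ha hb
    simp [he, ha, hb]

end SimpleGraph

theorem binCayley_adj {n : ℕ} {Ω : Set (Fin n → ZMod 2)} (h0 : 0 ∉ Ω) {x y : Fin n → ZMod 2} :
    (binCayley Ω).Adj x y ↔ x + y ∈ Ω := by
  rw [binCayley, SimpleGraph.fromRel_adj, add_comm y x, or_self, and_iff_right_iff_imp]
  rintro h rfl
  exact h0 (by rwa [ZModModule.add_self] at h)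

theorem projCube_adj {d : ℕ} [NeZero d] {x y : Fin d → ZMod 2} :
    (projCube d).Adj x y ↔ (∃ i, x + y = Pi.single i 1) ∨ x + y = fun _ => 1 := by
  refine binCayley_adj ?_
  rintro (⟨i, h⟩ | h)
  · simpa using congrFun h i
  · simpa using congrFun h 0

theorem projCube_preconnected (d : ℕ) [NeZero d] : (projCube d).Preconnected := by
  have key (z : Fin d → ZMod 2) : ∀ x, (projCube d).Reachable x (x + z) := by
    induction z using Pi.single_induction with
    | zero => simp
    | add f g hf hg =>
      intro x
      rw [← add_assoc]
      exact (hf x).trans (hg _)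
    | single i m =>
      intro x
      obtain rfl | rfl : m = 0 ∨ m = 1 := by revert m; decide
      · simp
      · refine SimpleGraph.Adj.reachable (projCube_adj.2 (.inl ⟨i, ?_⟩))
        rw [← add_assoc, CharTwo.add_self_eq_zero, zero_add]
  intro x y
  have h := key (x + y) x
  rwa [← add_assoc, CharTwo.add_self_eq_zero, zero_add] at h

open Classical in
/-- Identification of the subsets of `V` with the functions `V → ZMod 2`. -/
noncomputable def setEquivZModTwo (V : Type*) : Set V ≃ (V → ZMod 2) where
  toFun A v := if v ∈ A then 1 else 0
  invFun x := {v | x v = 1}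
  left_inv A := by ext; simp
  right_inv x := by
    funext v
    have : x v = 0 ∨ x v = 1 := by generalize x v = m; revert m; decide
    obtain h | h := this <;> simp [h]

theorem setEquivZModTwo_symmDiff {V : Type*} (A B : Set V) :
    setEquivZModTwo V (symmDiff A B) = setEquivZModTwo V A + setEquivZModTwo V B := by
  classical
  funext v
  by_cases hA : v ∈ A <;> by_cases hB : v ∈ B <;>
    simp [setEquivZModTwo, Set.mem_symmDiff, hA, hB, CharTwo.add_self_eq_zero]

theorem setEquivZModTwo_pair {V : Type*} [DecidableEq V] {u v : V} (h : u ≠ v) :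
    setEquivZModTwo V {u, v} = Pi.single u 1 + Pi.single v 1 := by
  funext w
  by_cases hu : w = u
  · subst hu
    simp [setEquivZModTwo, h]
  · by_cases hv : w = v <;> simp [setEquivZModTwo, Pi.single_apply, hu, hv]
    grind

theorem powerGraph_adj {V : Type*} [DecidableEq V] {G : SimpleGraph V} {A B : Set V} :
    (powerGraph G).Adj A B ↔ ∃ u v, G.Adj u v ∧
      setEquivZModTwo V A + setEquivZModTwo V B = Pi.single u 1 + Pi.single v 1 := by
  have key (u v : V) (h : G.Adj u v) : symmDiff A B = {u, v} ↔
      setEquivZModTwo V A + setEquivZModTwo V B = Pi.single u 1 + Pi.single v 1 := by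
    rw [← setEquivZModTwo_pair h.ne, ← setEquivZModTwo_symmDiff, EmbeddingLike.apply_eq_iff_eq]
  rw [powerGraph, SimpleGraph.fromRel_adj, symmDiff_comm B A, or_self]
  simp only [← exists_and_left]
  refine exists_congr fun u => exists_congr fun v => ?_
  constructor
  · rintro ⟨-, h, h'⟩
    exact ⟨h, (key u v h).1 h'⟩
  · rintro ⟨h, h'⟩
    rw [← key u v h] at h'
    refine ⟨?_, h, h'⟩
    rintro rfl
    simpa using (Set.ext_iff.1 h' u)

/-- The partial sums `i ↦ ∑ j ≤ i, x j`. -/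
def prefixSum (n : ℕ) : (Fin n → ZMod 2) →+ (Fin n → ZMod 2) where
  toFun x i := ∑ j ∈ Finset.Iic i, x j
  map_zero' := by ext; simp
  map_add' x y := by ext; simp [Finset.sum_add_distrib]

theorem prefixSum_injective (n : ℕ) : Function.Injective (prefixSum n) := by
  rw [injective_iff_map_eq_zero]
  intro x hx
  funext i
  induction i using WellFoundedLT.induction with
  | ind i ih =>
    have h : ∑ j ∈ Finset.Iic i, x j = 0 := congrFun hx i
    rwa [Finset.sum_eq_single i
      (fun j hj hji => ih j (lt_of_le_of_ne (Finset.mem_Iic.1 hj) hji)) (by simp)] at h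

theorem prefixSum_single {n : ℕ} (u i : Fin n) :
    prefixSum n (Pi.single u 1) i = if u ≤ i then 1 else 0 := by
  simp [prefixSum]

theorem prefixSum_single_add_succ {n : ℕ} (i : Fin n) :
    prefixSum (n + 1) (Pi.single i.castSucc 1 + Pi.single i.succ 1) =
      Fin.snoc (α := fun _ => ZMod 2) (Pi.single i 1) 0 := by
  funext j
  rw [map_add, Pi.add_apply, prefixSum_single, prefixSum_single]
  induction j using Fin.lastCases with
  | last => simp [Fin.le_last, CharTwo.add_self_eq_zero]
  | cast j =>
    rw [Fin.snoc_castSucc, Pi.single_apply]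
    simp only [Fin.le_def, Fin.ext_iff, Fin.val_castSucc, Fin.val_succ]
    rcases lt_trichotomy i.val j.val with h | h | h
    · rw [if_pos h.le, if_pos (by omega), if_neg (by omega), CharTwo.add_self_eq_zero]
    · rw [if_pos h.le, if_neg (by omega), if_pos h.symm, add_zero]
    · rw [if_neg (by omega), if_neg (by omega), if_neg (by omega), add_zero]

theorem prefixSum_single_last_add_zero {n : ℕ} :
    prefixSum (n + 1) (Pi.single (Fin.last n) 1 + Pi.single 0 1) =
      Fin.snoc (α := fun _ => ZMod 2) (fun _ => 1) 0 := by
  funext j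
  rw [map_add, Pi.add_apply, prefixSum_single, prefixSum_single]
  induction j using Fin.lastCases with
  | last => simp [CharTwo.add_self_eq_zero]
  | cast j => simp [Fin.le_def, j.isLt]

/-- A subset of `Fin (n + 1)` is determined by the parities of its proper initial segments,
together with the parity of its cardinality. -/
noncomputable def prefixParityEquiv (n : ℕ) :
    Set (Fin (n + 1)) ≃ (Fin n → ZMod 2) × ZMod 2 :=
  ((setEquivZModTwo _).trans
    (Equiv.ofBijective _ (Finite.injective_iff_bijective.1 (prefixSum_injective (n + 1))))).trans
    ((Fin.snocEquiv fun _ => ZMod 2).symm.trans (Equiv.prodComm _ _))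

theorem prefixParityEquiv_apply {n : ℕ} (A : Set (Fin (n + 1))) :
    prefixParityEquiv n A = (Fin.init (prefixSum (n + 1) (setEquivZModTwo _ A)),
      prefixSum (n + 1) (setEquivZModTwo _ A) (Fin.last n)) :=
  rfl

theorem add_eq_snoc_zero_iff {n : ℕ} {x y : Fin (n + 1) → ZMod 2} {z : Fin n → ZMod 2} :
    x + y = Fin.snoc (α := fun _ => ZMod 2) z 0 ↔
      x (Fin.last n) = y (Fin.last n) ∧ (Fin.init x + Fin.init y : Fin n → ZMod 2) = z := by
  simp only [funext_iff, Fin.forall_fin_succ', Pi.add_apply, Fin.snoc_castSucc, Fin.snoc_last,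
    Fin.init, CharTwo.add_eq_zero]
  exact and_comm

theorem powerGraph_cycleGraph_adj {n : ℕ} (A B : Set (Fin (n + 2))) :
    (powerGraph (cycleGraph (n + 2))).Adj A B ↔
      (prefixParityEquiv (n + 1) A).2 = (prefixParityEquiv (n + 1) B).2 ∧
      (projCube (n + 1)).Adj (prefixParityEquiv (n + 1) A).1 (prefixParityEquiv (n + 1) B).1 := by
  have edges : (powerGraph (cycleGraph (n + 2))).Adj A B ↔ ∃ u : Fin (n + 2),
      setEquivZModTwo _ A + setEquivZModTwo _ B = Pi.single u 1 + Pi.single (u + 1) 1 := by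
    rw [powerGraph_adj]
    constructor
    · rintro ⟨u, v, h | h, h'⟩
      · rw [sub_eq_iff_eq_add'] at h
        exact ⟨v, by rw [h', h]; exact add_comm _ _⟩
      · rw [sub_eq_iff_eq_add'] at h
        exact ⟨u, by rw [h', h]⟩
    · rintro ⟨u, h⟩
      exact ⟨u, u + 1, cycleGraph_adj.2 (.inr (by simp)), h⟩
  rw [edges, Fin.exists_fin_succ', projCube_adj, prefixParityEquiv_apply, prefixParityEquiv_apply,
    and_or_left, ← exists_and_left]
  simp only [← add_eq_snoc_zero_iff, ← map_add, Fin.coeSucc_eq_succ, Fin.last_add_one,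
    ← prefixSum_single_add_succ, ← prefixSum_single_last_add_zero,
    (prefixSum_injective _).eq_iff]

/-- For `n ≥ 3`, the power graph of the cycle `C_n` has exactly two connected
components, each isomorphic to the projective cube `PC_{n-1}`. -/
theorem powerGraph_cycle (n : ℕ) (hn : 3 ≤ n) :
    ∃ C₁ C₂ : (powerGraph (cycleGraph n)).ConnectedComponent,
      C₁ ≠ C₂ ∧ (∀ C, C = C₁ ∨ C = C₂) ∧
      ∀ C : (powerGraph (cycleGraph n)).ConnectedComponent,
        Nonempty (((powerGraph (cycleGraph n)).induce C.supp) ≃g projCube (n - 1)) := by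
  obtain ⟨k, rfl⟩ := Nat.exists_eq_add_of_le' hn
  have hH := projCube_preconnected (k + 2)
  have he := powerGraph_cycleGraph_adj (n := k + 1)
  have hr := SimpleGraph.reachable_iff_snd_eq hH _ he
  let e := prefixParityEquiv (k + 2)
  refine ⟨connectedComponentMk _ (e.symm (0, 0)), connectedComponentMk _ (e.symm (0, 1)), ?_, ?_,
    SimpleGraph.nonempty_induce_supp_iso hH _ he⟩
  · rw [Ne, ConnectedComponent.eq, hr]
    simp [e]
  · intro C
    induction C using ConnectedComponent.ind with | _ A
    rw [ConnectedComponent.eq, ConnectedComponent.eq, hr, hr]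
    simp only [e, Equiv.apply_symm_apply]
    generalize (prefixParityEquiv (k + 2) A).2 = m
    revert m
    decide
end

section
/- Let k ≥ 1 and let f : PC_{2k+2} → PC_{2k} be a graph homomorphism. If x and y are distinct vertices of PC_{2k+2} with f(x) = f(y), then x and y have a common neighbor in PC_{2k+2}, i.e., they are at distance 2. -/
open SimpleGraph

lemma hammingDist_add_single_of_eq {d : ℕ} {u t : Fin d → ZMod 2} {i : Fin d}
    (h : u i = t i) : hammingDist (u + Pi.single i 1) t = hammingDist u t + 1 := by
  have hset : ({j | (u + Pi.single i 1 : Fin d → ZMod 2) j ≠ t j} : Finset (Fin d)) =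
      insert i ({j | u j ≠ t j} : Finset (Fin d)) := by
    ext j
    rcases eq_or_ne j i with rfl | hj
    · simp [h]
    · simp [hj]
  unfold hammingDist
  rw [hset, Finset.card_insert_of_notMem (by simp [h])]

lemma add_single_add_single {d : ℕ} (u : Fin d → ZMod 2) (i : Fin d) :
    u + Pi.single i 1 + Pi.single i 1 = u := by
  rw [add_assoc, ZModModule.add_self, add_zero]

lemma ZMod.add_one_eq_iff_ne (a b : ZMod 2) : a + 1 = b ↔ a ≠ b := by
  revert a b
  decide

lemma hammingDist_add_single_of_ne {d : ℕ} {u t : Fin d → ZMod 2} {i : Fin d}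
    (h : u i ≠ t i) : hammingDist (u + Pi.single i 1) t + 1 = hammingDist u t := by
  have h' : (u + Pi.single i 1 : Fin d → ZMod 2) i = t i := by
    simpa using (ZMod.add_one_eq_iff_ne _ _).2 h
  rw [← hammingDist_add_single_of_eq h', add_single_add_single]

lemma hammingDist_add_one_add_hammingDist {d : ℕ} (u t : Fin d → ZMod 2) :
    hammingDist (u + 1) t + hammingDist u t = d := by
  have h := Finset.card_filter_add_card_filter_not (s := (Finset.univ : Finset (Fin d)))
    (fun j => u j ≠ t j)
  rw [Finset.card_univ, Fintype.card_fin, add_comm] at h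
  simpa [hammingDist, ← ZMod.add_one_eq_iff_ne] using h

lemma projCube_adj_add_single {d : ℕ} (u : Fin d → ZMod 2) (i : Fin d) :
    (projCube d).Adj u (u + Pi.single i 1) := by
  refine ⟨fun h => ?_, .inl (.inl ⟨i, ?_⟩)⟩
  · simpa using congrFun h i
  · rw [← add_assoc, ZModModule.add_self, zero_add]

lemma projCube_adj_add_one {d : ℕ} (hd : 0 < d) (u : Fin d → ZMod 2) :
    (projCube d).Adj u (u + 1) := by
  refine ⟨fun h => ?_, .inl (.inr ?_)⟩
  · simpa using congrFun h ⟨0, hd⟩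
  · change u + (u + 1) = 1
    rw [← add_assoc, ZModModule.add_self, zero_add]

lemma projCube_adj_cases {d : ℕ} {u v : Fin d → ZMod 2} (h : (projCube d).Adj u v) :
    (∃ i, v = u + Pi.single i 1) ∨ v = u + 1 := by
  have hmem : u + v ∈ ({x | ∃ i, x = Pi.single i 1} ∪ {x | x = fun _ => 1} :
      Set (Fin d → ZMod 2)) := by
    rcases h.2 with h | h
    · exact h
    · rwa [add_comm]
  have hv : v = u + (u + v) := by
    rw [← add_assoc, ZModModule.add_self, zero_add]
  rcases hmem with ⟨i, hi⟩ | h1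
  · exact .inl ⟨i, hi ▸ hv⟩
  · exact .inr (hv.trans (congrArg (u + ·) h1))

lemma projCube_walk_length {d : ℕ} {u v : Fin d → ZMod 2} (p : (projCube d).Walk u v) :
    (∃ r, p.length = hammingDist u v + 2 * r) ∨
      ∃ r, p.length + hammingDist u v = d + 1 + 2 * r := by
  induction p with
  | nil => exact .inl ⟨0, by simp⟩
  | @cons a b c hab p ih =>
    rw [Walk.length_cons]
    have hle : hammingDist a c ≤ d := by
      simpa using hammingDist_le_card_fintype (x := a) (y := c)
    rcases projCube_adj_cases hab with ⟨i, rfl⟩ | rfl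
    · by_cases h : a i = c i
      · have := hammingDist_add_single_of_eq h
        rcases ih with ⟨r, hr⟩ | ⟨r, hr⟩
        · exact .inl ⟨r + 1, by omega⟩
        · exact .inr ⟨r, by omega⟩
      · have := hammingDist_add_single_of_ne h
        rcases ih with ⟨r, hr⟩ | ⟨r, hr⟩
        · exact .inl ⟨r, by omega⟩
        · exact .inr ⟨r + 1, by omega⟩
    · have := hammingDist_add_one_add_hammingDist a c
      rcases ih with ⟨r, hr⟩ | ⟨r, hr⟩
      · exact .inr ⟨r, by omega⟩
      · exact .inl ⟨r + 1, by omega⟩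

/-- Closed walks of odd length in the projective cube of dimension `d` have length at least `d + 1`. -/
lemma projCube_lt_length_of_odd {d : ℕ} {u v : Fin d → ZMod 2} (huv : u = v)
    (p : (projCube d).Walk u v) (hp : Odd p.length) : d < p.length := by
  subst huv
  obtain ⟨s, hs⟩ := hp
  rcases projCube_walk_length p with ⟨r, hr⟩ | ⟨r, hr⟩ <;> rw [hammingDist_self] at hr <;> omega

lemma projCube_exists_walk_length_eq_hammingDist {d : ℕ} (u v : Fin d → ZMod 2) :
    ∃ p : (projCube d).Walk u v, p.length = hammingDist u v := by
  induction hm : hammingDist u v generalizing u with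
  | zero =>
    obtain rfl := hammingDist_eq_zero.1 hm
    exact ⟨.nil, rfl⟩
  | succ m ih =>
    obtain ⟨i, hi⟩ : ∃ i, u i ≠ v i := by
      by_contra! h
      rw [funext h, hammingDist_self] at hm
      omega
    obtain ⟨p, hp⟩ := ih (u + Pi.single i 1) (by have := hammingDist_add_single_of_ne hi; omega)
    exact ⟨.cons (projCube_adj_add_single u i) p, by simp [hp]⟩

lemma projCube_exists_walk_length_add_hammingDist {d : ℕ} (hd : 0 < d) (u v : Fin d → ZMod 2) :
    ∃ p : (projCube d).Walk u v, p.length + hammingDist u v = d + 1 := by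
  obtain ⟨p, hp⟩ := projCube_exists_walk_length_eq_hammingDist (u + 1) v
  have := hammingDist_add_one_add_hammingDist u v
  exact ⟨.cons (projCube_adj_add_one hd u) p, by rw [Walk.length_cons]; omega⟩

lemma SimpleGraph.Walk.exists_adj_adj_of_length_eq_two {V : Type*} {G : SimpleGraph V} {u v : V}
    (p : G.Walk u v) (hp : p.length = 2) : ∃ z, G.Adj u z ∧ G.Adj v z := by
  match p, hp with
  | .cons h (.cons h' .nil), _ => exact ⟨_, h, h'.symm⟩

/-- If `f : PC_{2k+2} → PC_{2k}` is a homomorphism identifying two distinct vertices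
`x` and `y`, then `x` and `y` have a common neighbor, i.e. they are at distance 2. -/
theorem projCube_hom_fibers_dist_two (k : ℕ) (hk : 1 ≤ k)
    (f : projCube (2 * k + 2) →g projCube (2 * k))
    (x y : Fin (2 * k + 2) → ZMod 2) (hxy : x ≠ y) (hf : f x = f y) :
    ∃ z, (projCube (2 * k + 2)).Adj x z ∧ (projCube (2 * k + 2)).Adj y z := by
  obtain ⟨p, hp⟩ := projCube_exists_walk_length_eq_hammingDist x y
  obtain ⟨q, hq⟩ := projCube_exists_walk_length_add_hammingDist (by omega) x y
  have hpos := hammingDist_pos.2 hxy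
  have hle : hammingDist x y ≤ 2 * k + 2 := by
    simpa using hammingDist_le_card_fintype (x := x) (y := y)
  rcases Nat.even_or_odd p.length with he | ho
  · have hlt := projCube_lt_length_of_odd hf (q.map f) (by
      rw [Walk.length_map, Nat.odd_iff]; rw [Nat.even_iff] at he; omega)
    rw [Walk.length_map] at hlt
    exact p.exists_adj_adj_of_length_eq_two (by rw [Nat.even_iff] at he; omega)
  · have hlt := projCube_lt_length_of_odd hf (p.map f) (by rwa [Walk.length_map])
    rw [Walk.length_map] at hlt
    exact q.exists_adj_adj_of_length_eq_two (by rw [Nat.odd_iff] at ho; omega)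
end

section
/- Let G be a binary Cayley graph whose odd-girth is 7. If G admits a graph homomorphism to PC_4, then every graph homomorphism from G to PC_4 is surjective. -/
open SimpleGraph

/-- `G` has odd-girth `g`: it contains a cycle of length `g` (with `g` odd this is an
odd cycle), and every odd cycle of `G` has length at least `g`. -/
def HasOddGirth {V : Type*} (G : SimpleGraph V) (g : ℕ) : Prop :=
  (∃ (u : V) (w : G.Walk u u), w.IsCycle ∧ w.length = g) ∧
    ∀ (u : V) (w : G.Walk u u), w.IsCycle → Odd w.length → g ≤ w.length

/-- Faces of the `n`-cube `(ℤ/2ℤ)^n`: a coordinate is either free (`none`) or fixed. -/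
abbrev CubeFace (n : ℕ) := Fin n → Option (ZMod 2)

namespace CubeFace

variable {n : ℕ}

/-- The vertices of a face. -/
def Mem (x : Fin n → ZMod 2) (q : CubeFace n) : Prop := ∀ i b, q i = some b → x i = b

/-- The vertex of a face whose free coordinates all vanish. -/
def base (q : CubeFace n) : Fin n → ZMod 2 := fun i => (q i).getD 0

/-- The antipodal face. -/
def antipode (q : CubeFace n) : CubeFace n := fun i => (q i).map (· + 1)

/-- The facet of `q` on which the coordinate `i` equals `b`. -/
def facet (q : CubeFace n) (i : Fin n) (b : ZMod 2) : CubeFace n := Function.update q i (some b)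

/-- The mod 2 cubical coboundary: the sum of a cochain over the facets of a face. -/
def coboundary (G : CubeFace n → ZMod 2) (q : CubeFace n) : ZMod 2 :=
  ∑ i, if q i = none then G (facet q i 0) + G (facet q i 1) else 0

/-- The sum of a cochain over the `k`-faces whose fixed coordinates alternate between
consecutive free coordinates. Together with their antipodes, these faces form a `k`-sphere
in the boundary of the cube. -/
def alternatingSum : (n k : ℕ) → (CubeFace n → ZMod 2) → ZMod 2
  | 0, 0, G => G Fin.elim0
  | 0, _ + 1, _ => 0
  | n + 1, 0, G => alternatingSum n 0 fun q => G (Fin.cons (some 0) q)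
  | n + 1, k + 1, G => alternatingSum n k (fun q => G (Fin.cons none q)) +
      alternatingSum n (k + 1) fun q => G (Fin.cons (some ((k + 1 : ℕ) : ZMod 2)) q)

theorem base_mem (q : CubeFace n) : Mem (base q) q := by
  intro i b h
  simp [base, h]

theorem mem_facet {x : Fin n → ZMod 2} {q : CubeFace n} {i : Fin n} (h : Mem x q) :
    Mem x (facet q i (x i)) := by
  intro j b hj
  by_cases hji : j = i
  · subst hji
    simpa [facet] using hj
  · exact h j b (by simpa [facet, hji] using hj)

theorem mem_of_mem_facet {x : Fin n → ZMod 2} {q : CubeFace n} {i : Fin n} {b : ZMod 2}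
    (hi : q i = none) (h : Mem x (facet q i b)) : Mem x q := by
  intro j c hj
  have hji : j ≠ i := by
    rintro rfl
    simp [hi] at hj
  exact h j c (by simpa [facet, hji] using hj)

theorem exists_mem_facet_facet {q : CubeFace n} {i j : Fin n} (hij : i ≠ j) (hi : q i = none)
    (hj : q j = none) (b c : ZMod 2) : ∃ x, Mem x (facet q i b) ∧ Mem x (facet q j c) := by
  refine ⟨base (facet (facet q i b) j c), mem_of_mem_facet (i := j) (b := c) ?_ (base_mem _),
    mem_of_mem_facet (i := i) (b := b) ?_ ?_⟩
  · simp [facet, hij.symm, hj]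
  · simp [facet, hij, hi]
  · rw [facet, facet, Function.update_comm hij]
    exact base_mem _

theorem base_facet_one {q : CubeFace n} {i : Fin n} :
    base (facet q i 1) = base (facet q i 0) + Pi.single i 1 := by
  funext j
  by_cases hji : j = i
  · subst hji
    simp [base, facet]
  · simp [base, facet, hji]

theorem base_antipode_add_one_mem (q : CubeFace n) : Mem (base (antipode q) + 1) q := by
  intro i b h
  simp [base, antipode, h, add_assoc, CharTwo.add_self_eq_zero]

theorem antipode_facet (q : CubeFace n) (i : Fin n) (b : ZMod 2) :
    antipode (facet q i b) = facet (antipode q) i (b + 1) := by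
  funext j
  by_cases hji : j = i
  · subst hji
    simp [antipode, facet]
  · simp [antipode, facet, hji]

theorem antipode_cons (b : Option (ZMod 2)) (q : CubeFace n) :
    antipode (Fin.cons b q : CubeFace (n + 1)) = Fin.cons (b.map (· + 1)) (antipode q) := by
  funext j
  refine Fin.cases ?_ (fun j => ?_) j <;> simp [antipode]

theorem coboundary_antipode (G : CubeFace n → ZMod 2) (q : CubeFace n) :
    coboundary G (antipode q) = coboundary (fun p => G (antipode p)) q := by
  refine Finset.sum_congr rfl fun i _ => ?_
  have h : antipode q i = none ↔ q i = none := by simp [antipode]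
  simp only [h, antipode_facet, zero_add, CharTwo.add_self_eq_zero]
  split_ifs
  · exact add_comm _ _
  · rfl

theorem coboundary_coboundary (G : CubeFace n → ZMod 2) (q : CubeFace n) :
    coboundary (coboundary G) q = 0 := by
  have key : coboundary (coboundary G) q = ∑ a : Fin n × Fin n,
      if a.1 ≠ a.2 ∧ q a.1 = none ∧ q a.2 = none then
        G (facet (facet q a.1 0) a.2 0) + G (facet (facet q a.1 0) a.2 1) +
        (G (facet (facet q a.1 1) a.2 0) + G (facet (facet q a.1 1) a.2 1)) else 0 := by
    rw [Fintype.sum_prod_type]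
    refine Finset.sum_congr rfl fun i _ => ?_
    by_cases hi : q i = none
    · simp only [hi, if_true, coboundary, ← Finset.sum_add_distrib]
      refine Finset.sum_congr rfl fun j _ => ?_
      by_cases hij : i = j
      · subst hij
        simp [facet]
      · by_cases hj : q j = none <;> simp [facet, Ne.symm hij, hij, hj]
    · simp [hi]
  rw [key]
  refine Finset.sum_involution (fun a _ => a.swap) ?_ ?_ (by simp) (by simp)
  · rintro ⟨i, j⟩ -
    by_cases h : i ≠ j ∧ q i = none ∧ q j = none
    · have h' : j ≠ i ∧ q j = none ∧ q i = none := ⟨h.1.symm, h.2.2, h.2.1⟩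
      have hc : ∀ b c, facet (facet q j b) i c = facet (facet q i c) j b := fun b c =>
        Function.update_comm h.1.symm _ _ _
      simp only [Prod.swap_prod_mk, if_pos h, if_pos h', hc]
      rw [add_add_add_comm (G (facet (facet q i 0) j 0)) (G (facet (facet q i 1) j 0))]
      exact CharTwo.add_self_eq_zero _
    · have h' : ¬ (j ≠ i ∧ q j = none ∧ q i = none) := fun h' => h ⟨h'.1.symm, h'.2.2, h'.2.1⟩
      simp only [Prod.swap_prod_mk, if_neg h, if_neg h', add_zero]
  · rintro ⟨i, j⟩ - hne h
    simp only [Prod.swap_prod_mk, Prod.mk.injEq] at h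
    simp [h.1] at hne

theorem coboundary_cons_none (G : CubeFace (n + 1) → ZMod 2) (q : CubeFace n) :
    coboundary G (Fin.cons none q) = G (Fin.cons (some 0) q) + G (Fin.cons (some 1) q) +
      coboundary (fun p => G (Fin.cons none p)) q := by
  simp [coboundary, Fin.sum_univ_succ, facet, Fin.cons_update]

theorem coboundary_cons_some (G : CubeFace (n + 1) → ZMod 2) (b : ZMod 2) (q : CubeFace n) :
    coboundary G (Fin.cons (some b) q) = coboundary (fun p => G (Fin.cons (some b) p)) q := by
  simp [coboundary, Fin.sum_univ_succ, facet, Fin.cons_update]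

theorem alternatingSum_add (k : ℕ) (G H : CubeFace n → ZMod 2) :
    alternatingSum n k (fun q => G q + H q) = alternatingSum n k G + alternatingSum n k H := by
  induction n generalizing k with
  | zero => cases k <;> simp [alternatingSum]
  | succ n ih =>
    cases k with
    | zero => simp only [alternatingSum, ih]
    | succ k =>
      simp only [alternatingSum, ih]
      exact add_add_add_comm _ _ _ _

theorem alternatingSum_zero (k : ℕ) : alternatingSum n k (fun _ => 0) = 0 := by
  induction n generalizing k with
  | zero => cases k <;> simp [alternatingSum]
  | succ n ih => cases k <;> simp [alternatingSum, ih]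

theorem alternatingSum_zero_eq_one {G : CubeFace n → ZMod 2}
    (h : ∀ q, (∀ i, q i ≠ none) → G q = 1) :
    alternatingSum n 0 G = 1 := by
  induction n with
  | zero => exact h _ fun i => i.elim0
  | succ n ih =>
    refine ih fun q hq => h _ fun i => ?_
    refine Fin.cases ?_ (fun i => ?_) i <;> simp [hq]

theorem alternatingSum_zero_coboundary (G : CubeFace n → ZMod 2) :
    alternatingSum n 0 (coboundary G) = 0 := by
  induction n with
  | zero => simp [alternatingSum, coboundary]
  | succ n ih => simp only [alternatingSum, coboundary_cons_some, ih]

/-- The `(k + 1)`-dimensional alternating chain bounds the sum of the `k`-dimensional one and its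
antipode. -/
theorem alternatingSum_succ_coboundary (k : ℕ) (G : CubeFace n → ZMod 2) :
    alternatingSum n (k + 1) (coboundary G) =
      alternatingSum n k G + alternatingSum n k fun q => G (antipode q) := by
  induction n generalizing k with
  | zero =>
    cases k with
    | zero =>
      have h : antipode (Fin.elim0 : CubeFace 0) = Fin.elim0 := Subsingleton.elim _ _
      simp [alternatingSum, h, CharTwo.add_self_eq_zero]
    | succ k => simp [alternatingSum]
  | succ n ih =>
    have hb : ∀ b : ZMod 2, (b = 0 ∧ b + 1 = 1) ∨ (b = 1 ∧ b + 1 = 0) := by decide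
    cases k with
    | zero =>
      simp only [alternatingSum, coboundary_cons_none, coboundary_cons_some, alternatingSum_add,
        ih, alternatingSum_zero_coboundary, antipode_cons, Option.map_some, zero_add,
        Nat.cast_one, add_zero]
      generalize alternatingSum n 0 (fun q => G (Fin.cons (some 1) q)) = a
      rw [← add_assoc, add_assoc _ a a, CharTwo.add_self_eq_zero, add_zero]
    | succ k =>
      simp only [alternatingSum, coboundary_cons_none, coboundary_cons_some, alternatingSum_add,
        ih, antipode_cons, Option.map_some, Option.map_none]
      have hk : ((k + 1 + 1 : ℕ) : ZMod 2) = ((k + 1 : ℕ) : ZMod 2) + 1 := by push_cast; rfl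
      rw [hk]
      rcases hb ((k + 1 : ℕ) : ZMod 2) with ⟨h, h'⟩ | ⟨h, h'⟩ <;> rw [h', h] <;> grind

theorem exists_ne_zero_of_alternatingSum {k : ℕ} {G : CubeFace n → ZMod 2}
    (h : alternatingSum n k G ≠ 0) : ∃ q, G q ≠ 0 := by
  by_contra! hG
  exact h (by rw [funext hG, alternatingSum_zero])

/-- The pullback along `F` of the `k`-cochain dual to the faces in the first `k` directions. -/
def pullback (F : (Fin n → ZMod 2) → ℕ → ZMod 2) : ℕ → CubeFace n → ZMod 2
  | 0 => fun q => if ∀ i, q i ≠ none then 1 else 0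
  | k + 1 => coboundary fun p => pullback F k p * F (base p) k

variable {F : (Fin n → ZMod 2) → ℕ → ZMod 2}

theorem coboundary_pullback (k : ℕ) (q : CubeFace n) : coboundary (pullback F k) q = 0 := by
  cases k with
  | zero =>
    rw [coboundary]
    refine Finset.sum_eq_zero fun i _ => ?_
    have h : (∀ j, facet q i 0 j ≠ none) ↔ ∀ j, facet q i 1 j ≠ none := by
      refine forall_congr' fun j => ?_
      by_cases hji : j = i
      · subst hji
        simp [facet]
      · simp [facet, hji]
    simp [pullback, h, CharTwo.add_self_eq_zero]
  | succ k => exact coboundary_coboundary _ q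

theorem exists_facets_of_pullback_succ_ne_zero {k : ℕ} {q : CubeFace n}
    (h : pullback F (k + 1) q ≠ 0) :
    ∃ i j b c, q i = none ∧ q j = none ∧ pullback F k (facet q i b) ≠ 0 ∧
      pullback F k (facet q j c) ≠ 0 ∧ F (base (facet q i b)) k ≠ F (base (facet q j c)) k := by
  by_contra! hcon
  apply h
  obtain ⟨t, ht⟩ : ∃ t, ∀ i b, q i = none → pullback F k (facet q i b) ≠ 0 →
      F (base (facet q i b)) k = t := by
    by_cases hex : ∃ j c, q j = none ∧ pullback F k (facet q j c) ≠ 0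
    · obtain ⟨j, c, hj, hc⟩ := hex
      exact ⟨_, fun i b hi hb => hcon i j b c hi hj hb hc⟩
    · exact ⟨0, fun i b hi hb => absurd ⟨i, b, hi, hb⟩ hex⟩
  have hmul : ∀ i b, q i = none → pullback F k (facet q i b) * F (base (facet q i b)) k =
      pullback F k (facet q i b) * t := by
    intro i b hi
    by_cases hz : pullback F k (facet q i b) = 0
    · simp [hz]
    · rw [ht i b hi hz]
  calc pullback F (k + 1) q = coboundary (pullback F k) q * t := by
        simp only [pullback, coboundary, Finset.sum_mul]
        refine Finset.sum_congr rfl fun i _ => ?_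
        split_ifs with hi
        · rw [hmul i 0 hi, hmul i 1 hi, add_mul]
        · rw [zero_mul]
    _ = 0 := by rw [coboundary_pullback, zero_mul]

/-- If the pullback of the dual `k`-cochain does not vanish on `q`, then `F` maps `q` onto a
face in the first `k` directions. -/
theorem onto_of_pullback_ne_zero
    (hF : ∀ x i, ∃ c, F (x + Pi.single i 1) = F x + Pi.single c 1)
    {k : ℕ} {q : CubeFace n} (h : pullback F k q ≠ 0) :
    (∀ x, Mem x q → ∀ a, k ≤ a → F x a = F (base q) a) ∧
      ∀ w : ℕ → ZMod 2, ∃ x, Mem x q ∧ ∀ a < k, F x a = w a := by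
  induction k generalizing q with
  | zero =>
    have hq : ∀ i, q i ≠ none := by
      by_contra hq
      simp [pullback, hq] at h
    have hx : ∀ x, Mem x q → x = base q := by
      intro x hx
      funext i
      obtain ⟨b, hb⟩ := Option.ne_none_iff_exists'.1 (hq i)
      rw [hx i b hb, base_mem q i b hb]
    exact ⟨fun x hxq a _ => by rw [hx x hxq], fun w => ⟨base q, base_mem q, by simp⟩⟩
  | succ k ih =>
    obtain ⟨i, j, b, c, hi, hj, hb, hc, hne⟩ := exists_facets_of_pullback_succ_ne_zero h
    have hij : i = j := by
      by_contra hij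
      obtain ⟨x, hxi, hxj⟩ := exists_mem_facet_facet hij hi hj b c
      exact hne (((ih hb).1 x hxi k le_rfl).symm.trans ((ih hc).1 x hxj k le_rfl))
    subst hij
    have hbits : ∀ s t u : ZMod 2, s ≠ t → u = s ∨ u = t := by decide
    have hbc : b ≠ c := by
      rintro rfl
      exact hne rfl
    have hp : ∀ d, pullback F k (facet q i d) ≠ 0 := by
      intro d
      rcases hbits b c d hbc with rfl | rfl <;> assumption
    have hne' : F (base (facet q i 0)) k ≠ F (base (facet q i 1)) k := by
      rcases hbits 0 1 b (by decide) with rfl | rfl <;>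
        rcases hbits 0 1 c (by decide) with rfl | rfl
      · exact absurd rfl hbc
      · exact hne
      · exact hne.symm
      · exact absurd rfl hbc
    have hbase : ∀ a, k + 1 ≤ a → F (base (facet q i 1)) a = F (base (facet q i 0)) a := by
      intro a ha
      obtain ⟨e, he⟩ := hF (base (facet q i 0)) i
      rw [← base_facet_one] at he
      have hek : k = e := by
        by_contra hek
        exact hne' (by simp [he, hek])
      have hae : a ≠ e := by omega
      simp [he, hae]
    have hconst : ∀ x, Mem x q → ∀ a, k + 1 ≤ a → F x a = F (base (facet q i 0)) a := by
      intro x hx a ha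
      rw [(ih (hp (x i))).1 x (mem_facet hx) a (by omega)]
      rcases hbits 0 1 (x i) (by decide) with h | h <;> rw [h]
      exact hbase a ha
    refine ⟨fun x hx a ha => (hconst x hx a ha).trans (hconst _ (base_mem q) a ha).symm,
      fun w => ?_⟩
    obtain ⟨d, hd⟩ : ∃ d, F (base (facet q i d)) k = w k := by
      rcases hbits _ _ (w k) hne' with h | h
      · exact ⟨0, h.symm⟩
      · exact ⟨1, h.symm⟩
    obtain ⟨x, hx, hxw⟩ := (ih (hp d)).2 w
    refine ⟨x, mem_of_mem_facet hi hx, fun a ha => ?_⟩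
    rcases Nat.lt_succ_iff_lt_or_eq.1 ha with ha | rfl
    · exact hxw a ha
    · rw [(ih (hp d)).1 x hx a le_rfl, hd]

theorem pullback_antipode_mul {m k : ℕ} (hk : k < m)
    (hF : ∀ x i, ∃ c, F (x + Pi.single i 1) = F x + Pi.single c 1)
    (hodd : ∀ x, ∀ a < m, F (x + 1) a = F x a + 1) (q : CubeFace n) :
    pullback F k q * F (base (antipode q)) k = pullback F k q * F (base q) k + pullback F k q := by
  by_cases h : pullback F k q = 0
  · simp [h]
  · have hb := (onto_of_pullback_ne_zero hF h).1 _ (base_antipode_add_one_mem q) k le_rfl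
    rw [hodd _ k hk] at hb
    rw [← hb, mul_add, mul_one, add_assoc, CharTwo.add_self_eq_zero, add_zero]

theorem pullback_antipode {m k : ℕ} (hk : k ≤ m)
    (hF : ∀ x i, ∃ c, F (x + Pi.single i 1) = F x + Pi.single c 1)
    (hodd : ∀ x, ∀ a < m, F (x + 1) a = F x a + 1) (q : CubeFace n) :
    pullback F k (antipode q) = pullback F k q := by
  induction k generalizing q with
  | zero => simp [pullback, antipode]
  | succ k ih =>
    have hsplit : coboundary (fun p => pullback F k p * F (base p) k + pullback F k p) q =
        coboundary (fun p => pullback F k p * F (base p) k) q + coboundary (pullback F k) q := by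
      simp only [coboundary, ← Finset.sum_add_distrib]
      refine Finset.sum_congr rfl fun i _ => ?_
      split_ifs
      · exact add_add_add_comm _ _ _ _
      · rw [add_zero]
    simp only [pullback, coboundary_antipode, ih (by omega : k ≤ m),
      pullback_antipode_mul (by omega : k < m) hF hodd]
    rw [hsplit, coboundary_pullback, add_zero]

theorem alternatingSum_pullback {m k : ℕ} (hk : k ≤ m)
    (hF : ∀ x i, ∃ c, F (x + Pi.single i 1) = F x + Pi.single c 1)
    (hodd : ∀ x, ∀ a < m, F (x + 1) a = F x a + 1) :
    alternatingSum n k (pullback F k) = 1 := by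
  induction k with
  | zero => exact alternatingSum_zero_eq_one fun q hq => by simp [pullback, hq]
  | succ k ih =>
    simp only [pullback, alternatingSum_succ_coboundary,
      pullback_antipode (by omega : k ≤ m) hF hodd,
      pullback_antipode_mul (by omega : k < m) hF hodd, alternatingSum_add]
    rw [← add_assoc, CharTwo.add_self_eq_zero, zero_add, ih (by omega)]

/-- A Borsuk–Ulam theorem for cubes: a map sending edges of the cube to edges and commuting with
the antipodal maps on the first `m` coordinates maps some face onto a face in the first `k ≤ m`
directions. -/
theorem exists_onto_face {m k : ℕ} (hk : k ≤ m)
    (hF : ∀ x i, ∃ c, F (x + Pi.single i 1) = F x + Pi.single c 1)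
    (hodd : ∀ x, ∀ a < m, F (x + 1) a = F x a + 1) :
    ∃ t : ℕ → ZMod 2, ∀ w : ℕ → ZMod 2,
      ∃ x, (∀ a < k, F x a = w a) ∧ ∀ a, k ≤ a → F x a = t a := by
  obtain ⟨q, hq⟩ := exists_ne_zero_of_alternatingSum
    (by rw [alternatingSum_pullback hk hF hodd]; exact one_ne_zero)
  obtain ⟨hconst, honto⟩ := onto_of_pullback_ne_zero hF hq
  refine ⟨F (base q), fun w => ?_⟩
  obtain ⟨x, hx, hxw⟩ := honto w
  exact ⟨x, hxw, hconst x hx⟩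

end CubeFace

theorem binCayley_adj_iff {n : ℕ} {Ω : Set (Fin n → ZMod 2)} {u v : Fin n → ZMod 2} :
    (binCayley Ω).Adj u v ↔ u ≠ v ∧ u + v ∈ Ω := by
  simp [binCayley, add_comm v u]

/-- A closed walk of length `g` in a binary Cayley graph yields `g` elements of the connection
set that sum to zero. -/
theorem exists_sum_eq_zero_of_walk {n : ℕ} {Ω : Set (Fin n → ZMod 2)} {u : Fin n → ZMod 2} {g : ℕ}
    (w : (binCayley Ω).Walk u u) (hw : w.length = g) :
    ∃ ω : Fin g → Fin n → ZMod 2, (∀ i, ω i ∈ Ω) ∧ ∑ i, ω i = 0 := by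
  subst hw
  refine ⟨fun i => w.getVert i + w.getVert (i + 1),
    fun i => (binCayley_adj_iff.1 (w.adj_getVert_succ i.2)).2, ?_⟩
  rw [Fin.sum_univ_eq_sum_range (fun i => w.getVert i + w.getVert (i + 1))]
  have h : ∀ i ∈ Finset.range w.length, w.getVert i + w.getVert (i + 1) =
      w.getVert (i + 1) - w.getVert i := fun i _ => by
    rw [ZModModule.sub_eq_add, add_comm]
  rw [Finset.sum_congr rfl h, Finset.sum_range_sub]
  simp

/-- The lift of a vertex of the projective cube of dimension `4` with parity `p` to the `5`-cube,
padded by zeros. -/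
def liftProjCube (y : Fin 4 → ZMod 2) (p : ZMod 2) (a : ℕ) : ZMod 2 :=
  if h : a < 4 then y ⟨a, h⟩ + (p + ∑ i, y i) else if a = 4 then p + ∑ i, y i else 0

theorem liftProjCube_add_one_of_adj {y z : Fin 4 → ZMod 2} (h : (projCube 4).Adj y z)
    (p : ZMod 2) : ∃ c, liftProjCube z (p + 1) = liftProjCube y p + Pi.single c 1 := by
  obtain ⟨-, h⟩ := binCayley_adj_iff.1 h
  have hz : z = y + (y + z) := by
    rw [← add_assoc, CharTwo.add_self_eq_zero, zero_add]
  rcases h with ⟨c, hc⟩ | hc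
  · rw [hc] at hz
    subst hz
    have hsum : p + 1 + ∑ i, (y + Pi.single c 1 : Fin 4 → ZMod 2) i = p + ∑ i, y i := by
      simp only [Pi.add_apply, Finset.sum_add_distrib, Finset.sum_pi_single', Finset.mem_univ,
        if_true]
      grind
    refine ⟨c, funext fun a => ?_⟩
    rw [Pi.add_apply]
    simp only [liftProjCube, hsum]
    simp only [Pi.add_apply, Pi.single_apply, Fin.ext_iff]
    split_ifs <;> first | omega | grind
  · replace hc : y + z = fun _ => 1 := hc
    rw [hc] at hz
    subst hz
    have hsum : p + 1 + ∑ i, (y i + 1) = p + ∑ i, y i + 1 := by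
      have h4 : (4 : ZMod 2) = 0 := by decide
      simp [Finset.sum_add_distrib, h4]
      ring
    refine ⟨4, funext fun a => ?_⟩
    simp only [liftProjCube, Pi.add_apply, hsum, Pi.single_apply]
    split_ifs <;> first | omega | grind

theorem liftProjCube_add_one (y : Fin 4 → ZMod 2) (p : ZMod 2) {a : ℕ} (ha : a < 5) :
    liftProjCube y (p + 1) a = liftProjCube y p a + 1 := by
  unfold liftProjCube
  split_ifs
  · ring
  · ring
  · omega

theorem liftProjCube_apply_add (y : Fin 4 → ZMod 2) (p : ZMod 2) (a : Fin 4) :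
    liftProjCube y p a + liftProjCube y p 4 = y a := by
  simp [liftProjCube, add_assoc, CharTwo.add_self_eq_zero]

/-- If a binary Cayley graph of odd-girth `7` admits a homomorphism to `PC_4`,
then every homomorphism from it to `PC_4` is surjective. -/
theorem binCayley_oddGirth_seven_hom_onto (n : ℕ)
    (Ω : Set (Fin n → ZMod 2)) (h0 : 0 ∉ Ω)
    (hog : HasOddGirth (binCayley Ω) 7)
    (hhom : Nonempty (binCayley Ω →g projCube 4))
    (f : binCayley Ω →g projCube 4) :
    Function.Surjective f := by
  obtain ⟨⟨u, w, -, hw⟩, -⟩ := hog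
  obtain ⟨ω, hω, hsum⟩ := exists_sum_eq_zero_of_walk w hw
  let g : (Fin 7 → ZMod 2) → Fin 4 → ZMod 2 := fun x => f (∑ i, x i • ω i)
  let F : (Fin 7 → ZMod 2) → ℕ → ZMod 2 := fun x => liftProjCube (g x) (∑ i, x i)
  have hF : ∀ x i, ∃ c, F (x + Pi.single i 1) = F x + Pi.single c 1 := by
    intro x i
    have hadj : (projCube 4).Adj (g x) (g (x + Pi.single i 1)) := by
      refine f.map_adj (binCayley_adj_iff.2 ?_)
      have hs : ∑ j, (x + Pi.single i 1 : Fin 7 → ZMod 2) j • ω j = ∑ j, x j • ω j + ω i := by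
        simp [add_smul, Finset.sum_add_distrib, Pi.single_apply]
      rw [hs, ← add_assoc, ZModModule.add_self, zero_add]
      refine ⟨fun h => h0 ?_, hω i⟩
      rw [← left_eq_add.1 h]
      exact hω i
    have hp : ∑ j, (x + Pi.single i 1 : Fin 7 → ZMod 2) j = ∑ j, x j + 1 := by
      simp [Finset.sum_add_distrib]
    simp only [F, hp]
    exact liftProjCube_add_one_of_adj hadj _
  have hodd : ∀ x, ∀ a < 5, F (x + 1) a = F x a + 1 := by
    intro x a ha
    have hg : g (x + 1) = g x := by
      simp [g, add_smul, Finset.sum_add_distrib, hsum]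
    have hp : ∑ j, (x + 1) j = ∑ j, x j + 1 := by
      have h7 : (7 : ZMod 2) = 1 := by decide
      simp [Finset.sum_add_distrib, h7]
    simp only [F, hg, hp]
    exact liftProjCube_add_one _ _ ha
  obtain ⟨t, ht⟩ := CubeFace.exists_onto_face (k := 4) (by norm_num) hF hodd
  intro y
  obtain ⟨x, hx, hxt⟩ := ht fun a => if h : a < 4 then y ⟨a, h⟩ + t 4 else 0
  refine ⟨∑ i, x i • ω i, funext fun a => ?_⟩
  have h : F x a + F x 4 = g x a := liftProjCube_apply_add _ _ a
  rw [hx a a.2, hxt 4 le_rfl] at h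
  simpa [add_assoc, CharTwo.add_self_eq_zero] using h.symm
end
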